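/- Let d ≥ 3 and let F : EuclideanSpace ℝ (Fin d) → EuclideanSpace ℝ (Fin d) be a vector field each of whose components is a Schwartz function. Let Φ = div F, φ(x) = ∫_{ℝ^d} Φ(y)·G(x−y) dy with G(x) = −(Γ(d/2−1)/(4π^{d/2}))·‖x‖^{2−d}, and let F^p = ∇φ and F^s = F − F^p. Then every longitudinal Radon transform of the potential part vanishes and the longitudinal transforms of F coincide with those of its solenoidal part: for every pair of orthonormal vectors ω, θ in ℝ^d and every p ∈ ℝ, ∫_{y ∈ (ℝ∙ω)ᗮ} ⟪θ, F^p(p•ω+y)⟫ dy = 0 and ∫_{y ∈ (ℝ∙ω)ᗮ} ⟪θ, F(p•ω+y)⟫ dy = ∫_{y ∈ (ℝ∙ω)ᗮ} ⟪θ, F^s(p•ω+y)⟫ dy. -/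

import Mathlib

open MeasureTheory Real
open scoped RealInnerProductSpace

noncomputable section

/-- The `j`-th canonical basis vector of `ℝ^d`. -/
def canE (d : ℕ) (j : Fin d) : EuclideanSpace ℝ (Fin d) := EuclideanSpace.single j 1

/-- Divergence of a vector field on `ℝ^d`: `div F x = ∑ⱼ ∂Fⱼ/∂xⱼ (x)`. -/
def vdiv {d : ℕ} (F : EuclideanSpace ℝ (Fin d) → EuclideanSpace ℝ (Fin d))
    (x : EuclideanSpace ℝ (Fin d)) : ℝ :=
  ∑ j, fderiv ℝ (fun y => ⟪canE d j, F y⟫) x (canE d j)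

/-- Laplacian of a scalar function on `ℝ^d` (sum of second partial derivatives). -/
def lap {d : ℕ} (f : EuclideanSpace ℝ (Fin d) → ℝ) (x : EuclideanSpace ℝ (Fin d)) : ℝ :=
  ∑ j, fderiv ℝ (fun y => fderiv ℝ f y (canE d j)) x (canE d j)

/-- A function is a Schwartz function if it agrees with an element of the Schwartz space. -/
def IsSchwartz {d : ℕ} (f : EuclideanSpace ℝ (Fin d) → ℝ) : Prop :=
  ∃ g : SchwartzMap (EuclideanSpace ℝ (Fin d)) ℝ, ∀ x, f x = g x

/-- The fundamental solution of the Laplace equation in `ℝ^d`, `d ≥ 3`: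
`G(x) = −(Γ(d/2−1)/(4 π^{d/2})) ‖x‖^{2−d}`. -/
def fundSol (d : ℕ) (x : EuclideanSpace ℝ (Fin d)) : ℝ :=
  -(Real.Gamma ((d : ℝ) / 2 - 1) / (4 * Real.pi ^ ((d : ℝ) / 2))) * ‖x‖ ^ ((2 : ℝ) - d)

/-- The Radon transform of a scalar function: integral over the hyperplane `⟪x,ω⟫ = p`,
parametrized as `x = p•ω + y`, `y ∈ (ℝ∙ω)ᗮ`. -/
def RadonT {d : ℕ} (f : EuclideanSpace ℝ (Fin d) → ℝ) (ω : EuclideanSpace ℝ (Fin d))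
    (p : ℝ) : ℝ :=
  ∫ y : ((ℝ ∙ ω)ᗮ : Submodule ℝ (EuclideanSpace ℝ (Fin d))),
    f (p • ω + (y : EuclideanSpace ℝ (Fin d)))

/-- The componentwise (vector-valued, Bochner) Radon transform of a vector field. -/
def RadonVec {d : ℕ} (F : EuclideanSpace ℝ (Fin d) → EuclideanSpace ℝ (Fin d))
    (ω : EuclideanSpace ℝ (Fin d)) (p : ℝ) : EuclideanSpace ℝ (Fin d) :=
  ∫ y : ((ℝ ∙ ω)ᗮ : Submodule ℝ (EuclideanSpace ℝ (Fin d))),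
    F (p • ω + (y : EuclideanSpace ℝ (Fin d)))

/-- The transversal Radon transform `[D^⊥F](ω,p)`. -/
def Dperp {d : ℕ} (F : EuclideanSpace ℝ (Fin d) → EuclideanSpace ℝ (Fin d))
    (ω : EuclideanSpace ℝ (Fin d)) (p : ℝ) : ℝ :=
  RadonT (fun x => ⟪ω, F x⟫) ω p

/-- The longitudinal Radon transform `[D_θ^∥F](ω,p)` for a direction `θ` orthogonal to `ω`. -/
def Dlong {d : ℕ} (F : EuclideanSpace ℝ (Fin d) → EuclideanSpace ℝ (Fin d))
    (ω θ : EuclideanSpace ℝ (Fin d)) (p : ℝ) : ℝ :=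
  RadonT (fun x => ⟪θ, F x⟫) ω p

/-- The weighted transversal Radon transform `[W_θ^⊥F](ω,p)` with linear weight `⟪θ,x⟫`. -/
def Wperp {d : ℕ} (F : EuclideanSpace ℝ (Fin d) → EuclideanSpace ℝ (Fin d))
    (ω θ : EuclideanSpace ℝ (Fin d)) (p : ℝ) : ℝ :=
  RadonT (fun x => ⟪θ, x⟫ * ⟪ω, F x⟫) ω p

/-- The weighted longitudinal Radon transform `[W_θ^∥F](ω,p)` with linear weight `⟪θ,x⟫`. -/
def Wlong {d : ℕ} (F : EuclideanSpace ℝ (Fin d) → EuclideanSpace ℝ (Fin d))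
    (ω θ : EuclideanSpace ℝ (Fin d)) (p : ℝ) : ℝ :=
  RadonT (fun x => ⟪θ, x⟫ * ⟪θ, F x⟫) ω p

open scoped SchwartzMap
open LineDeriv

/-- Japanese bracket power `(1+‖x‖²)^s`. -/
def jb {V : Type*} [NormedAddCommGroup V] (s : ℝ) (x : V) : ℝ := (1 + ‖x‖ ^ 2) ^ s

section JB
variable {V : Type*} [NormedAddCommGroup V]

lemma jb_base_pos (x : V) : 0 < 1 + ‖x‖ ^ 2 := by positivity

lemma jb_base_one (x : V) : 1 ≤ 1 + ‖x‖ ^ 2 := by nlinarith [sq_nonneg ‖x‖]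

lemma jb_pos (s : ℝ) (x : V) : 0 < jb s x := Real.rpow_pos_of_pos (jb_base_pos x) s

lemma jb_cont (s : ℝ) : Continuous (jb s : V → ℝ) := by
  unfold jb
  exact Continuous.rpow_const (by fun_prop) (fun x => Or.inl (jb_base_pos x).ne')

lemma jb_mono {s t : ℝ} (h : s ≤ t) (x : V) : jb s x ≤ jb t x :=
  Real.rpow_le_rpow_of_exponent_le (jb_base_one x) h

lemma jb_zero (x : V) : jb 0 x = 1 := by simp [jb]

lemma jb_le_one {s : ℝ} (h : s ≤ 0) (x : V) : jb s x ≤ 1 := by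
  simpa [jb_zero] using jb_mono h x

lemma jb_add (s t : ℝ) (x : V) : jb (s + t) x = jb s x * jb t x :=
  Real.rpow_add (jb_base_pos x) s t

lemma jb_one (x : V) : jb 1 x = 1 + ‖x‖ ^ 2 := by simp [jb]

lemma jb_neg_mul (s : ℝ) (x : V) : jb (-s) x * jb s x = 1 := by
  rw [← jb_add]; simp [jb_zero]

lemma norm_le_jb_half (x : V) : ‖x‖ ≤ jb (1 / 2) x := by
  unfold jb
  rw [← Real.sqrt_eq_rpow]
  exact Real.le_sqrt_of_sq_le (by linarith)

lemma peetre {s : ℝ} (hs : 0 ≤ s) (x y : V) :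
    jb s x ≤ 2 ^ s * (jb s (x - y) * jb s y) := by
  unfold jb
  rw [← Real.mul_rpow (jb_base_pos _).le (jb_base_pos _).le,
    ← Real.mul_rpow (by norm_num) (by positivity)]
  refine Real.rpow_le_rpow (jb_base_pos _).le ?_ hs
  have h : ‖x‖ ≤ ‖x - y‖ + ‖y‖ := by
    simpa using norm_add_le (x - y) y
  have h2 : ‖x‖ ^ 2 ≤ (‖x - y‖ + ‖y‖) ^ 2 := by gcongr
  nlinarith [sq_nonneg (‖x - y‖ - ‖y‖), sq_nonneg (‖x - y‖ * ‖y‖)]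

lemma jb_integrable [NormedSpace ℝ V] [FiniteDimensional ℝ V] [MeasurableSpace V] [BorelSpace V]
    (μ : Measure V) [μ.IsAddHaarMeasure] {s : ℝ} (h : (Module.finrank ℝ V : ℝ) < 2 * s) :
    Integrable (jb (-s) : V → ℝ) μ := by
  have := integrable_rpow_neg_one_add_norm_sq (E := V) (μ := μ) h
  refine this.congr (Filter.Eventually.of_forall fun x => ?_)
  simp only [jb]
  congr 1; ring

lemma schwartz_decay [NormedSpace ℝ V] {W : Type*} [NormedAddCommGroup W] [NormedSpace ℝ W]
    (f : 𝓢(V, W)) (s : ℝ) : ∃ C, 0 ≤ C ∧ ∀ x, ‖f x‖ ≤ C * jb (-s) x := by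
  obtain ⟨k, hk⟩ := exists_nat_ge (2 * s)
  refine ⟨2 ^ k * (((Finset.Iic (k, 0)).sup fun m : ℕ × ℕ => SchwartzMap.seminorm ℝ m.1 m.2) f),
    by positivity, fun x => ?_⟩
  have h := SchwartzMap.one_add_le_sup_seminorm_apply (𝕜 := ℝ) (m := (k, 0)) (le_refl k)
    (le_refl 0) f x
  simp only [norm_iteratedFDeriv_zero] at h
  have h1 : jb s x ≤ (1 + ‖x‖) ^ k := by
    calc jb s x ≤ jb ((k : ℝ) / 2) x := jb_mono (by linarith) x
      _ ≤ ((1 + ‖x‖) ^ 2) ^ ((k : ℝ) / 2) := by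
        refine Real.rpow_le_rpow (jb_base_pos x).le ?_ (by positivity)
        nlinarith [norm_nonneg x]
      _ = (1 + ‖x‖) ^ k := by
        rw [← Real.rpow_natCast (1 + ‖x‖) 2, ← Real.rpow_mul (by positivity),
          ← Real.rpow_natCast]
        congr 1; push_cast; ring
  have h2 : jb s x * ‖f x‖ ≤ (1 + ‖x‖) ^ k * ‖f x‖ := by gcongr
  calc ‖f x‖ = (jb s x * ‖f x‖) * jb (-s) x := by
        rw [mul_right_comm, mul_comm (jb s x), jb_neg_mul, one_mul]
    _ ≤ _ := mul_le_mul_of_nonneg_right (h2.trans h) (jb_pos _ _).le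

end JB

lemma jb_hasFDerivAt {V : Type*} [NormedAddCommGroup V] [InnerProductSpace ℝ V] (s : ℝ) (x : V) :
    HasFDerivAt (jb s : V → ℝ) ((2 * s * jb (s - 1) x) • innerSL ℝ x) x := by
  have h1 : HasFDerivAt (fun y : V => 1 + ‖y‖ ^ 2) (2 • innerSL ℝ x) x :=
    ((hasStrictFDerivAt_norm_sq x).hasFDerivAt).const_add 1
  have h2 := h1.rpow_const (p := s) (Or.inl (jb_base_pos x).ne')
  refine h2.congr_fderiv ?_
  ext v
  simp [jb]
  ring

/-- the singular part of the kernel. -/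
def k0 (d : ℕ) (y : EuclideanSpace ℝ (Fin d)) : ℝ :=
  (Metric.ball (0 : EuclideanSpace ℝ (Fin d)) 1).indicator (fun y => ‖y‖ ^ ((2 : ℝ) - d)) y

lemma k0_nonneg (d : ℕ) (y : EuclideanSpace ℝ (Fin d)) : 0 ≤ k0 d y :=
  Set.indicator_nonneg (fun _ _ => by positivity) y

lemma k0_integrable (d : ℕ) (hd : 3 ≤ d) : Integrable (k0 d) := by
  unfold k0
  refine IntegrableOn.integrable_indicator ?_ measurableSet_ball
  refine integrableOn_ball_of_norm_le_rpow (C := 1) (α := (d : ℝ) - 2) ?_ ?_ ?_ ?_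
  · simp; omega
  · simp
  · refine Filter.Eventually.of_forall fun x => ?_
    rw [Real.norm_of_nonneg (by positivity)]; simp
  · exact (measurable_norm.pow_const _).aestronglyMeasurable

lemma conv_bound (d : ℕ) (hd : 3 ≤ d) (f : 𝓢(EuclideanSpace ℝ (Fin d), ℝ))
    (K : EuclideanSpace ℝ (Fin d) → ℝ) (s A : ℝ) (hs : 0 ≤ s) (hA : 0 ≤ A)
    (hK : ∀ y, |K y| ≤ A * (jb (-s) y * (1 + k0 d y))) :
    ∃ C, 0 ≤ C ∧ ∀ x, |∫ y, f (x - y) * K y| ≤ C * jb (-s) x := by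
  obtain ⟨C, hC, hf⟩ := schwartz_decay f (s + d)
  have hint : Integrable (jb (-(d : ℝ)) : EuclideanSpace ℝ (Fin d) → ℝ) := by
    refine jb_integrable volume ?_
    have : (0 : ℝ) < d := by exact_mod_cast (by omega : 0 < d)
    simp; linarith
  refine ⟨∫ y, (2 ^ s * C * A) * (jb (-(d : ℝ)) y + k0 d y), ?_, fun x => ?_⟩
  · refine integral_nonneg fun y => ?_
    have := k0_nonneg d y
    have := jb_pos (-(d : ℝ)) y
    simp only [Pi.zero_apply]
    positivity
  · have h1 : ∀ y, ‖f (x - y) * K y‖ ≤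
        ((2 ^ s * C * A) * (jb (-(d : ℝ)) (x - y) + k0 d y)) * jb (-s) x := by
      intro y
      have hk := k0_nonneg d y
      have e1 : ‖f (x - y) * K y‖ ≤ (C * jb (-(s + d)) (x - y)) * (A * (jb (-s) y * (1 + k0 d y))) := by
        rw [norm_mul]
        exact mul_le_mul (hf _) (hK y) (norm_nonneg _) (mul_nonneg hC (jb_pos _ _).le)
      refine e1.trans ?_
      have e2 : jb (-s) (x - y) * jb (-s) y ≤ 2 ^ s * jb (-s) x := by
        have hp := peetre hs x y
        have a1 := jb_neg_mul s x
        have a2 := jb_neg_mul s (x - y)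
        have a3 := jb_neg_mul s y
        have p1 := jb_pos (-s) x
        have p2 := jb_pos (-s) (x - y)
        have p3 := jb_pos (-s) y
        calc jb (-s) (x - y) * jb (-s) y
            = (jb (-s) (x - y) * jb (-s) y * jb (-s) x) * jb s x := by
              linear_combination (-(jb (-s) (x - y) * jb (-s) y)) * a1
          _ ≤ (jb (-s) (x - y) * jb (-s) y * jb (-s) x) * (2 ^ s * (jb s (x - y) * jb s y)) := by
              gcongr
          _ = 2 ^ s * jb (-s) x * (jb (-s) (x - y) * jb s (x - y)) * (jb (-s) y * jb s y) := by ring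
          _ = _ := by rw [a2, a3]; ring
      have e3 : jb (-(d : ℝ)) (x - y) * (1 + k0 d y) ≤ jb (-(d : ℝ)) (x - y) + k0 d y := by
        have : jb (-(d : ℝ)) (x - y) ≤ 1 := jb_le_one (by simp) _
        nlinarith
      have p4 := jb_pos (-(d : ℝ)) (x - y)
      have p5 := jb_pos (-s) x
      calc (C * jb (-(s + d)) (x - y)) * (A * (jb (-s) y * (1 + k0 d y)))
          = C * A * (jb (-s) (x - y) * jb (-s) y) * (jb (-(d : ℝ)) (x - y) * (1 + k0 d y)) := by
            rw [show -(s + (d : ℝ)) = -s + -(d : ℝ) by ring, jb_add]; ring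
        _ ≤ C * A * (2 ^ s * jb (-s) x) * (jb (-(d : ℝ)) (x - y) + k0 d y) := by gcongr
        _ = _ := by ring
    have hi1 : Integrable (fun y => jb (-(d : ℝ)) (x - y)) := hint.comp_sub_left x
    have h2 := norm_integral_le_of_norm_le
      (((hi1.add (k0_integrable d hd)).const_mul (2 ^ s * C * A)).mul_const (jb (-s) x))
      (Filter.Eventually.of_forall h1)
    rw [← Real.norm_eq_abs]
    refine h2.trans (le_of_eq ?_)
    rw [integral_mul_const, integral_const_mul, integral_const_mul, integral_add hint (k0_integrable d hd)]
    congr 2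
    change ∫ y, (jb (-(d : ℝ)) (x - y) + k0 d y) = _
    rw [integral_add hi1 (k0_integrable d hd), integral_sub_left_eq_self (f := (jb (-(d : ℝ)) : EuclideanSpace ℝ (Fin d) → ℝ))]

/-- radial kernel. -/
def nk (d : ℕ) (y : EuclideanSpace ℝ (Fin d)) : ℝ := ‖y‖ ^ ((2 : ℝ) - d)

lemma nk_nonneg (d : ℕ) (y : EuclideanSpace ℝ (Fin d)) : 0 ≤ nk d y := by
  unfold nk; positivity

lemma nk_meas (d : ℕ) : Measurable (nk d) := measurable_norm.pow_const _

lemma nk_le (d : ℕ) (hd : 3 ≤ d) (y : EuclideanSpace ℝ (Fin d)) : nk d y ≤ 1 + k0 d y := by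
  have hd' : (3 : ℝ) ≤ d := by exact_mod_cast hd
  unfold nk k0
  by_cases h : y ∈ Metric.ball (0 : EuclideanSpace ℝ (Fin d)) 1
  · rw [Set.indicator_of_mem h]; linarith
  · rw [Set.indicator_of_notMem h]
    have h1 : 1 ≤ ‖y‖ := by simpa using h
    have := Real.rpow_le_one_of_one_le_of_nonpos h1 (by linarith : (2 : ℝ) - d ≤ 0)
    linarith

lemma nk_diff_bound (d : ℕ) (hd : 3 ≤ d) : ∃ A, 0 ≤ A ∧ ∀ y : EuclideanSpace ℝ (Fin d),
    |nk d y - jb ((2 - (d : ℝ)) / 2) y| ≤ A * (jb (-((d : ℝ) / 2)) y * (1 + k0 d y)) := by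
  have hd' : (3 : ℝ) ≤ d := by exact_mod_cast hd
  refine ⟨d * 2 ^ ((d : ℝ) / 2), by positivity, fun y => ?_⟩
  have hk := k0_nonneg d y
  have hj0 := jb_pos ((2 - (d : ℝ)) / 2) y
  have hj1 : jb ((2 - (d : ℝ)) / 2) y ≤ 1 := jb_le_one (by linarith) y
  have hn := nk_nonneg d y
  have hjd := jb_pos (-((d : ℝ) / 2)) y
  by_cases h : ‖y‖ < 1
  · have h1 : |nk d y - jb ((2 - (d : ℝ)) / 2) y| ≤ 1 + k0 d y := by
      have := nk_le d hd y
      rw [abs_le]; constructor <;> linarith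
    have h2 : 1 ≤ 2 ^ ((d : ℝ) / 2) * jb (-((d : ℝ) / 2)) y := by
      have : jb ((d : ℝ) / 2) y ≤ 2 ^ ((d : ℝ) / 2) :=
        Real.rpow_le_rpow (jb_base_pos y).le (by nlinarith [norm_nonneg y]) (by positivity)
      calc (1 : ℝ) = jb ((d : ℝ) / 2) y * jb (-((d : ℝ) / 2)) y := by
            rw [mul_comm, jb_neg_mul]
        _ ≤ _ := by gcongr
    have h3 : 1 ≤ d * 2 ^ ((d : ℝ) / 2) * jb (-((d : ℝ) / 2)) y := by nlinarith
    calc _ ≤ 1 * (1 + k0 d y) := by linarith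
      _ ≤ (d * 2 ^ ((d : ℝ) / 2) * jb (-((d : ℝ) / 2)) y) * (1 + k0 d y) := by gcongr
      _ = _ := by ring
  · push Not at h
    set r := ‖y‖ with hr
    have hr0 : 0 < r := by linarith
    set a := ((d : ℝ) - 2) / 2 with ha
    have ha0 : 0 < a := by rw [ha]; linarith
    have e1 : nk d y = (r ^ 2) ^ (-a) := by
      unfold nk
      rw [← Real.rpow_natCast r 2, ← Real.rpow_mul hr0.le]
      congr 1; rw [ha]; push_cast; ring
    have e2 : jb ((2 - (d : ℝ)) / 2) y = (r ^ 2) ^ (-a) * (1 + 1 / r ^ 2) ^ (-a) := by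
      unfold jb
      rw [← Real.mul_rpow (by positivity) (by positivity)]
      congr 1
      · field_simp; rw [← hr]; ring
      · rw [ha]; ring
    have e3 : 1 - a * (1 / r ^ 2) ≤ (1 + 1 / r ^ 2) ^ (-a) := by
      have hp : 0 < 1 + 1 / r ^ 2 := by positivity
      rw [Real.rpow_def_of_pos hp]
      have l1 := Real.log_le_sub_one_of_pos hp
      have l2 := Real.add_one_le_exp (Real.log (1 + 1 / r ^ 2) * -a)
      nlinarith
    have e4 : (1 + 1 / r ^ 2) ^ (-a) ≤ 1 :=
      Real.rpow_le_one_of_one_le_of_nonpos (by have : 0 < 1 / r ^ 2 := by positivity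
                                               linarith) (by linarith)
    have e5 : (r ^ 2) ^ (-a) * (1 / r ^ 2) = (r ^ 2) ^ (-((d : ℝ) / 2)) := by
      rw [one_div, ← Real.rpow_neg_one (r ^ 2), ← Real.rpow_add (by positivity)]
      congr 1; rw [ha]; ring
    have e6 : (r ^ 2) ^ (-((d : ℝ) / 2)) ≤ 2 ^ ((d : ℝ) / 2) * jb (-((d : ℝ) / 2)) y := by
      unfold jb
      rw [Real.rpow_neg (by positivity), Real.rpow_neg (by positivity), ← div_eq_mul_inv,
        inv_eq_one_div, div_le_div_iff₀ (by positivity) (by positivity), one_mul,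
        ← Real.mul_rpow (by norm_num) (by positivity)]
      refine Real.rpow_le_rpow (by positivity) ?_ (by positivity)
      rw [← hr]; nlinarith
    have hq : 0 < (r ^ 2) ^ (-a) := by positivity
    rw [e1, e2, abs_of_nonneg (by nlinarith)]
    calc (r ^ 2) ^ (-a) - (r ^ 2) ^ (-a) * (1 + 1 / r ^ 2) ^ (-a)
        ≤ a * ((r ^ 2) ^ (-a) * (1 / r ^ 2)) := by nlinarith
      _ ≤ a * (2 ^ ((d : ℝ) / 2) * jb (-((d : ℝ) / 2)) y) := by rw [e5]; gcongr
      _ ≤ d * (2 ^ ((d : ℝ) / 2) * jb (-((d : ℝ) / 2)) y) := by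
        gcongr; rw [ha]; linarith
      _ = d * 2 ^ ((d : ℝ) / 2) * (jb (-((d : ℝ) / 2)) y * 1) := by ring
      _ ≤ _ := by gcongr; linarith

lemma jb_shift {V : Type*} [NormedAddCommGroup V] {s : ℝ} (hs : 0 ≤ s) (x y : V) :
    jb (-s) (x - y) ≤ 2 ^ s * jb s x * jb (-s) y := by
  have hp := peetre hs y (y - x)
  rw [show y - (y - x) = x by abel, show jb s (y - x) = jb s (x - y) by
    simp only [jb, norm_sub_rev]] at hp
  have a1 := jb_neg_mul s (x - y)
  have a2 := jb_neg_mul s y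
  have p1 := jb_pos (-s) (x - y)
  have p2 := jb_pos (-s) y
  calc jb (-s) (x - y) = jb (-s) (x - y) * jb (-s) y * jb s y := by
        linear_combination (-jb (-s) (x - y)) * a2
    _ ≤ jb (-s) (x - y) * jb (-s) y * (2 ^ s * (jb s x * jb s (x - y))) := by gcongr
    _ = 2 ^ s * jb s x * jb (-s) y * (jb (-s) (x - y) * jb s (x - y)) := by ring
    _ = _ := by rw [a1, mul_one]

lemma base_integrable (d : ℕ) (hd : 3 ≤ d) :
    Integrable (fun y : EuclideanSpace ℝ (Fin d) => jb (-(d : ℝ)) y + k0 d y) := by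
  refine Integrable.add ?_ (k0_integrable d hd)
  refine jb_integrable volume ?_
  have : (0 : ℝ) < d := by exact_mod_cast (by omega : 0 < d)
  simp; linarith

lemma local_dom (d : ℕ) {W : Type*} [NormedAddCommGroup W] [NormedSpace ℝ W]
    (f : 𝓢(EuclideanSpace ℝ (Fin d), W))
    (K : EuclideanSpace ℝ (Fin d) → ℝ) (A : ℝ) (hA : 0 ≤ A)
    (hK : ∀ y, |K y| ≤ A * (1 + k0 d y)) (x₀ : EuclideanSpace ℝ (Fin d)) :
    ∃ C, ∀ x ∈ Metric.ball x₀ 1, ∀ y, ‖K y • f (x - y)‖ ≤ C * (jb (-(d : ℝ)) y + k0 d y) := by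
  obtain ⟨C, hC, hf⟩ := schwartz_decay f d
  refine ⟨A * C * (2 ^ (d : ℝ) * (2 ^ (d : ℝ) * (2 ^ (d : ℝ) * jb (d : ℝ) x₀))), fun x hx y => ?_⟩
  have hk := k0_nonneg d y
  have h1 : jb (d : ℝ) x ≤ 2 ^ (d : ℝ) * (2 ^ (d : ℝ) * jb (d : ℝ) x₀) := by
    refine (peetre (by positivity) x x₀).trans ?_
    have p := jb_pos (d : ℝ) x₀
    gcongr
    refine Real.rpow_le_rpow (jb_base_pos _).le ?_ (by positivity)
    have : ‖x - x₀‖ < 1 := by simpa [dist_eq_norm] using hx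
    nlinarith [norm_nonneg (x - x₀)]
  have h2 := jb_shift (s := (d : ℝ)) (by positivity) x y
  have p2 := jb_pos (-(d : ℝ)) y
  have p3 := jb_pos (d : ℝ) x₀
  have h3 : jb (-(d : ℝ)) y * (1 + k0 d y) ≤ jb (-(d : ℝ)) y + k0 d y := by
    have : jb (-(d : ℝ)) y ≤ 1 := jb_le_one (by simp) _
    nlinarith
  rw [norm_smul]
  calc ‖K y‖ * ‖f (x - y)‖ ≤ (A * (1 + k0 d y)) * (C * jb (-(d : ℝ)) (x - y)) :=
        mul_le_mul (hK y) (hf _) (norm_nonneg _) (by positivity)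
    _ ≤ (A * (1 + k0 d y)) * (C * (2 ^ (d : ℝ) * (2 ^ (d : ℝ) * (2 ^ (d : ℝ) * jb (d : ℝ) x₀))
          * jb (-(d : ℝ)) y)) := by
        gcongr
        refine h2.trans ?_
        gcongr
    _ = A * C * (2 ^ (d : ℝ) * (2 ^ (d : ℝ) * (2 ^ (d : ℝ) * jb (d : ℝ) x₀))) *
          (jb (-(d : ℝ)) y * (1 + k0 d y)) := by ring
    _ ≤ _ := by gcongr

lemma conv_integrable (d : ℕ) (hd : 3 ≤ d) {W : Type*} [NormedAddCommGroup W] [NormedSpace ℝ W]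
    (f : 𝓢(EuclideanSpace ℝ (Fin d), W))
    (K : EuclideanSpace ℝ (Fin d) → ℝ) (hKm : Measurable K) (A : ℝ) (hA : 0 ≤ A)
    (hK : ∀ y, |K y| ≤ A * (1 + k0 d y)) (x : EuclideanSpace ℝ (Fin d)) :
    Integrable (fun y => K y • f (x - y)) := by
  obtain ⟨C, hC⟩ := local_dom d f K A hA hK x
  refine ((base_integrable d hd).const_mul C).mono' ?_
    (Filter.Eventually.of_forall (hC x (Metric.mem_ball_self one_pos)))
  exact hKm.aestronglyMeasurable.smul
    ((f.continuous.comp (continuous_const.sub continuous_id)).aestronglyMeasurable)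

lemma conv_hasFDerivAt (d : ℕ) (hd : 3 ≤ d) (f : 𝓢(EuclideanSpace ℝ (Fin d), ℝ))
    (K : EuclideanSpace ℝ (Fin d) → ℝ) (hKm : Measurable K) (A : ℝ) (hA : 0 ≤ A)
    (hK : ∀ y, |K y| ≤ A * (1 + k0 d y)) (x : EuclideanSpace ℝ (Fin d)) :
    HasFDerivAt (fun x => ∫ y, f (x - y) * K y)
      (∫ y, K y • (SchwartzMap.fderivCLM ℝ _ _ f) (x - y)) x := by
  obtain ⟨C, hC⟩ := local_dom d (SchwartzMap.fderivCLM ℝ _ _ f) K A hA hK x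
  have hm : ∀ z, Integrable (fun y => f (z - y) * K y) := fun z => by
    simpa [mul_comm] using conv_integrable d hd f K hKm A hA hK z
  refine hasFDerivAt_integral_of_dominated_of_fderiv_le
    (F' := fun x y => K y • (SchwartzMap.fderivCLM ℝ _ _ f) (x - y))
    (Metric.ball_mem_nhds x one_pos)
    (Filter.Eventually.of_forall fun z => (hm z).aestronglyMeasurable) (hm x)
    (conv_integrable d hd _ K hKm A hA hK x).aestronglyMeasurable
    (Filter.Eventually.of_forall fun y z hz => hC z hz y)
    ((base_integrable d hd).const_mul C)
    (Filter.Eventually.of_forall fun y z hz => ?_)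
  have h1 : HasFDerivAt (fun z => f (z - y)) (fderiv ℝ f (z - y)) z := by
    exact ((f.differentiableAt (x := z - y)).hasFDerivAt.comp z
      ((hasFDerivAt_id z).sub_const y)).congr_fderiv (by ext; simp)
  simpa using h1.mul_const (K y)

lemma conv_fderiv_apply (d : ℕ) (hd : 3 ≤ d) (f : 𝓢(EuclideanSpace ℝ (Fin d), ℝ))
    (K : EuclideanSpace ℝ (Fin d) → ℝ) (hKm : Measurable K) (A : ℝ) (hA : 0 ≤ A)
    (hK : ∀ y, |K y| ≤ A * (1 + k0 d y)) (x v : EuclideanSpace ℝ (Fin d)) :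
    fderiv ℝ (fun x => ∫ y, f (x - y) * K y) x v = ∫ y, (∂_{v} f) (x - y) * K y := by
  rw [(conv_hasFDerivAt d hd f K hKm A hA hK x).fderiv,
    ContinuousLinearMap.integral_apply (conv_integrable d hd _ K hKm A hA hK x)]
  refine integral_congr_ae (Filter.Eventually.of_forall fun y => ?_)
  simp [SchwartzMap.lineDerivOp_apply_eq_fderiv, mul_comm]

lemma conv_ibp (d : ℕ) (f : 𝓢(EuclideanSpace ℝ (Fin d), ℝ))
    (g g' : EuclideanSpace ℝ (Fin d) → ℝ) (v : EuclideanSpace ℝ (Fin d)) (A : ℝ)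
    (hg : Continuous g) (hg' : Continuous g') (hgA : ∀ y, |g y| ≤ A) (hgA' : ∀ y, |g' y| ≤ A)
    (hd : ∀ y, HasLineDerivAt ℝ g (g' y) y v) (x : EuclideanSpace ℝ (Fin d)) :
    ∫ y, (∂_{v} f) (x - y) * g y = ∫ y, f (x - y) * g' y := by
  have hint : ∀ (h : 𝓢(EuclideanSpace ℝ (Fin d), ℝ)) (k : EuclideanSpace ℝ (Fin d) → ℝ),
      Continuous k → (∀ y, |k y| ≤ A) → Integrable (fun y => h (x - y) * k y) := by
    intro h k hk hkA
    exact (h.integrable.comp_sub_left x).mul_bdd hk.aestronglyMeasurable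
      (Filter.Eventually.of_forall hkA)
  have key := integral_bilinear_hasLineDerivAt_right_eq_neg_left_of_integrable
    (μ := (volume : Measure (EuclideanSpace ℝ (Fin d))))
    (f := fun y => f (x - y)) (f' := fun y => -(∂_{v} f) (x - y)) (g := g) (g' := g') (v := v)
    (B := ContinuousLinearMap.mul ℝ ℝ)
    (by simpa using (hint (∂_{v} f) g hg hgA).neg) (by simpa using hint f g' hg' hgA')
    (by simpa using hint f g hg hgA) (fun y _ => ?_) (fun y _ => hd y)
  · simp only [ContinuousLinearMap.mul_apply', neg_mul, integral_neg, neg_neg] at key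
    exact key.symm
  · have h1 : HasFDerivAt (fun z => f (x - z)) (-(fderiv ℝ f (x - y))) y := by
      exact ((f.differentiableAt (x := x - y)).hasFDerivAt.comp y
        ((hasFDerivAt_id y).const_sub x)).congr_fderiv (by ext; simp)
    simpa [SchwartzMap.lineDerivOp_apply_eq_fderiv] using h1.hasLineDerivAt v

lemma jb_lineDeriv {V : Type*} [NormedAddCommGroup V] [InnerProductSpace ℝ V] (s : ℝ) (y v : V) :
    HasLineDerivAt ℝ (jb s) (2 * s * (jb (s - 1) y * ⟪y, v⟫)) y v := by
  have := (jb_hasFDerivAt s y).hasLineDerivAt v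
  simpa [mul_assoc] using this

lemma jb_lineDeriv2 {V : Type*} [NormedAddCommGroup V] [InnerProductSpace ℝ V] (s : ℝ) (y v w : V) :
    HasLineDerivAt ℝ (fun y => 2 * s * (jb (s - 1) y * ⟪y, v⟫))
      (2 * s * (2 * (s - 1) * (jb (s - 1 - 1) y * ⟪y, w⟫) * ⟪y, v⟫ + jb (s - 1) y * ⟪w, v⟫)) y w := by
  have h1 : HasFDerivAt (fun y : V => ⟪y, v⟫) (innerSL ℝ v) y := by
    refine ((innerSL ℝ v).hasFDerivAt (x := y)).congr_of_eventuallyEq ?_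
    exact Filter.Eventually.of_forall fun z => by simp [real_inner_comm]
  have := (((jb_hasFDerivAt (s - 1) y).mul h1).const_mul (2 * s)).hasLineDerivAt w
  convert this using 1
  · rfl
  change _ = 2 * s * (jb (s - 1) y * ⟪v, w⟫ + ⟪y, v⟫ * (2 * (s - 1) * jb (s - 1 - 1) y * ⟪y, w⟫))
  rw [real_inner_comm v w]
  ring

lemma jb_d1_bound {V : Type*} [NormedAddCommGroup V] [InnerProductSpace ℝ V] (s : ℝ) (y v : V) :
    |2 * s * (jb (s - 1) y * ⟪y, v⟫)| ≤ (2 * |s| * ‖v‖) * jb (s - 1 / 2) y := by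
  have h1 : |⟪y, v⟫| ≤ ‖y‖ * ‖v‖ := abs_real_inner_le_norm y v
  have h2 := norm_le_jb_half y
  have p := jb_pos (s - 1) y
  rw [abs_mul, abs_mul, abs_mul, abs_of_pos p, abs_two]
  calc 2 * |s| * (jb (s - 1) y * |⟪y, v⟫|) ≤ 2 * |s| * (jb (s - 1) y * (jb (1 / 2) y * ‖v‖)) := by
        gcongr
        exact h1.trans (by gcongr)
    _ = 2 * |s| * ‖v‖ * (jb (s - 1) y * jb (1 / 2) y) := by ring
    _ = _ := by rw [← jb_add]; congr 2; ring

lemma jb_d2_bound {V : Type*} [NormedAddCommGroup V] [InnerProductSpace ℝ V] (s : ℝ) (y v w : V) :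
    |2 * s * (2 * (s - 1) * (jb (s - 1 - 1) y * ⟪y, w⟫) * ⟪y, v⟫ + jb (s - 1) y * ⟪w, v⟫)| ≤
      (2 * |s| * (2 * |s - 1| + 1) * (‖w‖ * ‖v‖)) * jb (s - 1) y := by
  have h1 : |⟪y, v⟫| ≤ jb (1 / 2) y * ‖v‖ :=
    (abs_real_inner_le_norm y v).trans (by gcongr; exact norm_le_jb_half y)
  have h2 : |⟪y, w⟫| ≤ jb (1 / 2) y * ‖w‖ :=
    (abs_real_inner_le_norm y w).trans (by gcongr; exact norm_le_jb_half y)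
  have h3 := abs_real_inner_le_norm w v
  have p := jb_pos (s - 1) y
  have p2 := jb_pos (s - 1 - 1) y
  have p3 := jb_pos (1 / 2) y
  have e : jb (s - 1 - 1) y * (jb (1 / 2) y * jb (1 / 2) y) = jb (s - 1) y := by
    rw [← jb_add, ← jb_add]; congr 1; ring
  have h4 : |2 * (s - 1) * (jb (s - 1 - 1) y * ⟪y, w⟫) * ⟪y, v⟫| ≤
      2 * |s - 1| * (‖w‖ * ‖v‖) * jb (s - 1) y := by
    rw [abs_mul, abs_mul, abs_mul, abs_mul, abs_of_pos p2, abs_two]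
    calc _ ≤ 2 * |s - 1| * (jb (s - 1 - 1) y * (jb (1 / 2) y * ‖w‖)) * (jb (1 / 2) y * ‖v‖) := by
          gcongr
      _ = 2 * |s - 1| * (‖w‖ * ‖v‖) * (jb (s - 1 - 1) y * (jb (1 / 2) y * jb (1 / 2) y)) := by ring
      _ = _ := by rw [e]
  have h5 : |jb (s - 1) y * ⟪w, v⟫| ≤ (‖w‖ * ‖v‖) * jb (s - 1) y := by
    rw [abs_mul, abs_of_pos p, mul_comm]; gcongr
  rw [abs_mul, abs_mul, abs_two]
  calc _ ≤ 2 * |s| * (2 * |s - 1| * (‖w‖ * ‖v‖) * jb (s - 1) y + (‖w‖ * ‖v‖) * jb (s - 1) y) := by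
        gcongr
        exact (abs_add_le _ _).trans (add_le_add h4 h5)
    _ = _ := by ring

lemma conv_split (d : ℕ) (hd : 3 ≤ d) (f : 𝓢(EuclideanSpace ℝ (Fin d), ℝ))
    (x : EuclideanSpace ℝ (Fin d)) :
    ∫ y, f (x - y) * nk d y = (∫ y, f (x - y) * (nk d y - jb ((2 - (d : ℝ)) / 2) y)) +
      ∫ y, f (x - y) * jb ((2 - (d : ℝ)) / 2) y := by
  have hd' : (3 : ℝ) ≤ d := by exact_mod_cast hd
  have i1 : Integrable (fun y => f (x - y) * nk d y) := by
    simpa [mul_comm] using conv_integrable d hd f (nk d) (nk_meas d) 1 zero_le_one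
      (fun y => by rw [abs_of_nonneg (nk_nonneg d y), one_mul]; exact nk_le d hd y) x
  have i2 : Integrable (fun y => f (x - y) * jb ((2 - (d : ℝ)) / 2) y) := by
    simpa [mul_comm] using conv_integrable d hd f (jb ((2 - (d : ℝ)) / 2))
      (jb_cont _).measurable 1 zero_le_one
      (fun y => by
        rw [abs_of_pos (jb_pos _ y), one_mul]
        have := jb_le_one (by linarith : (2 - (d : ℝ)) / 2 ≤ 0) y
        have := k0_nonneg d y
        linarith) x
  rw [← integral_add _ i2]
  · congr 1; ext y; ring
  · have := i1.sub i2
    refine this.congr (Filter.Eventually.of_forall fun y => ?_)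
    simp only [Pi.sub_apply]; ring

lemma g1_cont {V : Type*} [NormedAddCommGroup V] [InnerProductSpace ℝ V] (s : ℝ) (v : V) :
    Continuous (fun y => 2 * s * (jb (s - 1) y * ⟪y, v⟫)) := by
  have := jb_cont (V := V) (s - 1)
  fun_prop

lemma g2_cont {V : Type*} [NormedAddCommGroup V] [InnerProductSpace ℝ V] (s : ℝ) (v w : V) :
    Continuous (fun y => 2 * s * (2 * (s - 1) * (jb (s - 1 - 1) y * ⟪y, w⟫) * ⟪y, v⟫
      + jb (s - 1) y * ⟪w, v⟫)) := by
  have := jb_cont (V := V) (s - 1)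
  have := jb_cont (V := V) (s - 1 - 1)
  fun_prop

lemma bound_u (d : ℕ) (hd : 3 ≤ d) (h : 𝓢(EuclideanSpace ℝ (Fin d), ℝ))
    (v : EuclideanSpace ℝ (Fin d)) :
    ∃ C, 0 ≤ C ∧ ∀ x, |∫ y, (∂_{v} h) (x - y) * nk d y| ≤ C * jb (-(((d : ℝ) - 1) / 2)) x := by
  have hd' : (3 : ℝ) ≤ d := by exact_mod_cast hd
  obtain ⟨A, hA, hn⟩ := nk_diff_bound d hd
  obtain ⟨C₁, hC₁, h1⟩ := conv_bound d hd (∂_{v} h) _ (((d : ℝ) - 1) / 2) A (by linarith) hA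
    (fun y => (hn y).trans (by
      have := k0_nonneg d y
      have := jb_mono (by linarith : (-((d : ℝ) / 2)) ≤ -(((d : ℝ) - 1) / 2)) y
      gcongr))
  set s := (2 - (d : ℝ)) / 2 with hs
  have b1 : ∀ y : EuclideanSpace ℝ (Fin d), |2 * s * (jb (s - 1) y * ⟪y, v⟫)| ≤
      (2 * |s| * ‖v‖) * jb (-(((d : ℝ) - 1) / 2)) y := fun y => by
    have := jb_d1_bound s y v
    rwa [show s - 1 / 2 = -(((d : ℝ) - 1) / 2) by rw [hs]; ring] at this
  obtain ⟨C₂, hC₂, h2⟩ := conv_bound d hd h (fun y => 2 * s * (jb (s - 1) y * ⟪y, v⟫))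
    (((d : ℝ) - 1) / 2) (2 * |s| * ‖v‖) (by linarith) (by positivity)
    (fun y => (b1 y).trans (by
      have := k0_nonneg d y
      have := jb_pos (-(((d : ℝ) - 1) / 2)) y
      gcongr
      nlinarith))
  refine ⟨C₁ + C₂, by positivity, fun x => ?_⟩
  rw [conv_split d hd, add_mul]
  refine (abs_add_le _ _).trans (add_le_add (h1 x) ?_)
  rw [conv_ibp d h _ _ v (1 + 2 * |s| * ‖v‖) (jb_cont s) (g1_cont s v) _ _ (jb_lineDeriv s · v)]
  · exact h2 x
  · intro y
    rw [abs_of_pos (jb_pos _ y)]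
    have := jb_le_one (by rw [hs]; linarith : s ≤ 0) y
    have : 0 ≤ 2 * |s| * ‖v‖ := by positivity
    linarith
  · intro y
    refine (b1 y).trans ?_
    have := jb_le_one (by linarith : (-(((d : ℝ) - 1) / 2)) ≤ 0) y
    have : 0 ≤ 2 * |s| * ‖v‖ := by positivity
    nlinarith

lemma bound_du (d : ℕ) (hd : 3 ≤ d) (h : 𝓢(EuclideanSpace ℝ (Fin d), ℝ))
    (v w : EuclideanSpace ℝ (Fin d)) :
    ∃ C, 0 ≤ C ∧ ∀ x, |∫ y, (∂_{v} (∂_{w} h)) (x - y) * nk d y| ≤ C * jb (-((d : ℝ) / 2)) x := by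
  have hd' : (3 : ℝ) ≤ d := by exact_mod_cast hd
  obtain ⟨A, hA, hn⟩ := nk_diff_bound d hd
  obtain ⟨C₁, hC₁, h1⟩ := conv_bound d hd (∂_{v} (∂_{w} h)) _ ((d : ℝ) / 2) A (by linarith) hA hn
  set s := (2 - (d : ℝ)) / 2 with hs
  have b1 : ∀ y : EuclideanSpace ℝ (Fin d), |2 * s * (jb (s - 1) y * ⟪y, v⟫)| ≤
      (2 * |s| * ‖v‖) := fun y => by
    refine (jb_d1_bound s y v).trans ?_
    have := jb_le_one (by rw [hs]; linarith : s - 1 / 2 ≤ 0) y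
    have : 0 ≤ 2 * |s| * ‖v‖ := by positivity
    nlinarith
  set B := (2 * |s| * (2 * |s - 1| + 1) * (‖w‖ * ‖v‖)) with hB
  have hB0 : 0 ≤ B := by positivity
  have b2 := fun y : EuclideanSpace ℝ (Fin d) => jb_d2_bound s y v w
  rw [← hB] at b2
  obtain ⟨C₂, hC₂, h2⟩ := conv_bound d hd h
    (fun y => 2 * s * (2 * (s - 1) * (jb (s - 1 - 1) y * ⟪y, w⟫) * ⟪y, v⟫ + jb (s - 1) y * ⟪w, v⟫))
    ((d : ℝ) / 2) B (by linarith) hB0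
    (fun y => (b2 y).trans (by
      have := k0_nonneg d y
      have := jb_pos (-((d : ℝ) / 2)) y
      rw [show s - 1 = -((d : ℝ) / 2) by rw [hs]; ring]
      gcongr
      nlinarith))
  refine ⟨C₁ + C₂, by positivity, fun x => ?_⟩
  rw [conv_split d hd, add_mul]
  refine (abs_add_le _ _).trans (add_le_add (h1 x) ?_)
  rw [conv_ibp d (∂_{w} h) _ _ v (1 + 2 * |s| * ‖v‖) (jb_cont s) (g1_cont s v) _ _
    (jb_lineDeriv s · v)]
  · rw [conv_ibp d h _ _ w (2 * |s| * ‖v‖ + B) (g1_cont s v) (g2_cont s v w) _ _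
      (jb_lineDeriv2 s · v w)]
    · exact h2 x
    · intro y; linarith [b1 y]
    · intro y
      refine (b2 y).trans ?_
      have := jb_le_one (by rw [hs]; linarith : s - 1 ≤ 0) y
      have : 0 ≤ 2 * |s| * ‖v‖ := by positivity
      nlinarith
  · intro y
    rw [abs_of_pos (jb_pos _ y)]
    have := jb_le_one (by rw [hs]; linarith : s ≤ 0) y
    have : 0 ≤ 2 * |s| * ‖v‖ := by positivity
    linarith
  · intro y
    linarith [b1 y]

/-- rational cut-off. -/
lemma cut_lineDeriv {V : Type*} [NormedAddCommGroup V] [InnerProductSpace ℝ V] (ε : ℝ) (hε : 0 ≤ ε)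
    (y v : V) :
    HasLineDerivAt ℝ (fun y : V => (1 + ε * ‖y‖ ^ 2)⁻¹)
      (-(2 * ε * ⟪y, v⟫) / (1 + ε * ‖y‖ ^ 2) ^ 2) y v := by
  have h1 : HasFDerivAt (fun y : V => 1 + ε * ‖y‖ ^ 2) (ε • (2 • innerSL ℝ y)) y :=
    (((hasStrictFDerivAt_norm_sq y).hasFDerivAt).const_mul ε).const_add 1
  have hp : 1 + ε * ‖y‖ ^ 2 ≠ 0 := by positivity
  have := ((hasDerivAt_inv hp).comp_hasFDerivAt y h1).hasLineDerivAt v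
  convert this using 1
  · rfl
  change _ = (-((1 + ε * ‖y‖ ^ 2) ^ 2)⁻¹) * (ε * (2 • ⟪y, v⟫))
  rw [nsmul_eq_mul]
  push_cast
  ring

lemma cut_deriv_bound {V : Type*} [NormedAddCommGroup V] [InnerProductSpace ℝ V] (ε : ℝ)
    (hε : 0 ≤ ε) (hε1 : ε ≤ 1) (y v : V) (hv : ‖v‖ = 1) :
    |-(2 * ε * ⟪y, v⟫) / (1 + ε * ‖y‖ ^ 2) ^ 2| ≤ 4 * jb (-(1 / 2)) y := by
  have h1 : |⟪y, v⟫| ≤ ‖y‖ := by simpa [hv] using abs_real_inner_le_norm y v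
  have hD : 1 ≤ 1 + ε * ‖y‖ ^ 2 := by have : 0 ≤ ε * ‖y‖ ^ 2 := by positivity
                                      linarith
  have hj : jb (1 / 2) y ≤ 1 + ‖y‖ := by
    unfold jb
    rw [← Real.sqrt_eq_rpow]
    refine Real.sqrt_le_iff.2 ⟨by positivity, by nlinarith [norm_nonneg y]⟩
  have p1 := jb_pos (-(1 / 2)) y
  have hn := norm_nonneg y
  rw [abs_div, abs_neg, abs_mul, abs_mul, abs_two, abs_of_nonneg hε, abs_of_pos (by positivity : 0 < (1 + ε * ‖y‖ ^ 2) ^ 2),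
    div_le_iff₀ (by positivity)]
  have e1 : ε * ‖y‖ * (1 + ‖y‖) ≤ 2 * (1 + ε * ‖y‖ ^ 2) := by
    have : ‖y‖ ≤ 1 + ‖y‖ ^ 2 := by nlinarith [sq_nonneg (‖y‖ - 1)]
    have : ε * ‖y‖ ≤ ε * (1 + ‖y‖ ^ 2) := by gcongr
    nlinarith
  have e2 : (1 + ε * ‖y‖ ^ 2) ≤ (1 + ε * ‖y‖ ^ 2) ^ 2 := by nlinarith
  calc 2 * ε * |⟪y, v⟫| ≤ 2 * ε * ‖y‖ := by gcongr
    _ = 2 * (ε * ‖y‖) * (jb (-(1 / 2)) y * jb (1 / 2) y) := by rw [jb_neg_mul]; ring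
    _ ≤ 2 * (ε * ‖y‖) * (jb (-(1 / 2)) y * (1 + ‖y‖)) := by gcongr
    _ = 2 * jb (-(1 / 2)) y * (ε * ‖y‖ * (1 + ‖y‖)) := by ring
    _ ≤ 2 * jb (-(1 / 2)) y * (2 * (1 + ε * ‖y‖ ^ 2) ^ 2) := by
        have := e1.trans (mul_le_mul_of_nonneg_left e2 zero_le_two)
        gcongr
    _ = _ := by ring

/-- Vanishing of the integral of a directional derivative, with critical decay. -/
lemma integral_lineDeriv_zero {V : Type*} [NormedAddCommGroup V] [InnerProductSpace ℝ V]
    [FiniteDimensional ℝ V] [MeasurableSpace V] [BorelSpace V] (n : ℝ)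
    (hn : n = Module.finrank ℝ V) (u u' : V → ℝ) (v : V) (hv : ‖v‖ = 1) (C : ℝ) (hC : 0 ≤ C)
    (hu : Continuous u) (hu' : Measurable u')
    (hd : ∀ y, HasLineDerivAt ℝ u (u' y) y v)
    (bu : ∀ y, |u y| ≤ C * jb (-(n / 2)) y) (bu' : ∀ y, |u' y| ≤ C * jb (-((n + 1) / 2)) y) :
    Integrable u' ∧ ∫ y, u' y = 0 := by
  have hint : Integrable (jb (-((n + 1) / 2)) : V → ℝ) := by
    refine jb_integrable volume ?_
    rw [← hn]; linarith
  have hi : Integrable u' := (hint.const_mul C).mono' hu'.aestronglyMeasurable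
    (Filter.Eventually.of_forall bu')
  refine ⟨hi, ?_⟩
  let e : ℕ → ℝ := fun k => 1 / ((k : ℝ) + 1)
  have e0 : ∀ k, 0 < e k := fun k => by positivity
  have e1 : ∀ k, e k ≤ 1 := fun k => by
    simp only [e]
    rw [div_le_one (by positivity)]
    have : (0 : ℝ) ≤ k := by positivity
    linarith
  have elim : Filter.Tendsto e Filter.atTop (nhds 0) := tendsto_one_div_add_atTop_nhds_zero_nat
  let g : ℕ → V → ℝ := fun k y => (1 + e k * ‖y‖ ^ 2)⁻¹
  let g' : ℕ → V → ℝ := fun k y => -(2 * e k * ⟪y, v⟫) / (1 + e k * ‖y‖ ^ 2) ^ 2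
  have hpos : ∀ k (y : V), 0 < 1 + e k * ‖y‖ ^ 2 := fun k y => by have := e0 k; positivity
  have gc : ∀ k, Continuous (g k) := fun k =>
    Continuous.inv₀ (by fun_prop) (fun y => (hpos k y).ne')
  have gc' : ∀ k, Continuous (g' k) := fun k =>
    Continuous.div (by fun_prop) (by fun_prop) (fun y => (pow_pos (hpos k y) 2).ne')
  have gb : ∀ k y, |g k y| ≤ 1 := fun k y => by
    rw [abs_of_pos (inv_pos.2 (hpos k y))]
    refine inv_le_one_of_one_le₀ ?_
    have : 0 ≤ e k * ‖y‖ ^ 2 := by have := e0 k; positivity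
    linarith
  have ub : ∀ k y, ‖u y * g' k y‖ ≤ (4 * C) * jb (-((n + 1) / 2)) y := fun k y => by
    rw [norm_mul]
    calc ‖u y‖ * ‖g' k y‖ ≤ (C * jb (-(n / 2)) y) * (4 * jb (-(1 / 2)) y) :=
          mul_le_mul (bu y) (cut_deriv_bound (e k) (e0 k).le (e1 k) y v hv) (norm_nonneg _)
            (mul_nonneg hC (jb_pos _ _).le)
      _ = (4 * C) * (jb (-(n / 2)) y * jb (-(1 / 2)) y) := by ring
      _ = _ := by rw [← jb_add]; congr 2; ring
  have i1 : ∀ k, Integrable (fun y => u y * g' k y) := fun k =>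
    (hint.const_mul (4 * C)).mono' (hu.mul (gc' k)).aestronglyMeasurable
      (Filter.Eventually.of_forall (ub k))
  have u'b : ∀ k y, ‖u' y * g k y‖ ≤ C * jb (-((n + 1) / 2)) y := fun k y => by
    rw [norm_mul]
    calc ‖u' y‖ * ‖g k y‖ ≤ (C * jb (-((n + 1) / 2)) y) * 1 :=
          mul_le_mul (bu' y) (gb k y) (norm_nonneg _) (mul_nonneg hC (jb_pos _ _).le)
      _ = _ := mul_one _
  have m2 : ∀ k, AEStronglyMeasurable (fun y => u' y * g k y) volume := fun k =>
    (hu'.mul (gc k).measurable).aestronglyMeasurable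
  have i2 : ∀ k, Integrable (fun y => u' y * g k y) := fun k =>
    (hint.const_mul C).mono' (m2 k) (Filter.Eventually.of_forall (u'b k))
  have i3 : ∀ k, Integrable (fun y => u y * g k y) := fun k => by
    have hint2 : Integrable (jb (-((n + 2) / 2)) : V → ℝ) := by
      refine jb_integrable volume ?_
      rw [← hn]; linarith
    refine (hint2.const_mul (C * (e k)⁻¹)).mono' (hu.mul (gc k)).aestronglyMeasurable
      (Filter.Eventually.of_forall fun y => ?_)
    have hg : ‖g k y‖ ≤ (e k)⁻¹ * jb (-1) y := by
      have := e0 k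
      rw [Real.norm_of_nonneg (inv_pos.2 (hpos k y)).le]
      simp only [jb, Real.rpow_neg_one]
      rw [← mul_inv]
      refine inv_anti₀ (by positivity) ?_
      nlinarith [e1 k]
    rw [norm_mul]
    calc ‖u y‖ * ‖g k y‖ ≤ (C * jb (-(n / 2)) y) * ((e k)⁻¹ * jb (-1) y) :=
          mul_le_mul (bu y) hg (norm_nonneg _) (mul_nonneg hC (jb_pos _ _).le)
      _ = C * (e k)⁻¹ * (jb (-(n / 2)) y * jb (-1) y) := by ring
      _ = _ := by rw [← jb_add]; congr 2; ring
  have key : ∀ k, ∫ y, u y * g' k y = - ∫ y, u' y * g k y := fun k =>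
    integral_bilinear_hasLineDerivAt_right_eq_neg_left_of_integrable
      (B := ContinuousLinearMap.mul ℝ ℝ) (by simpa using i2 k) (by simpa using i1 k)
      (by simpa using i3 k) (fun y _ => hd y)
      (fun y _ => cut_lineDeriv (e k) (e0 k).le y v)
  have l1 : Filter.Tendsto (fun k => ∫ y, u y * g' k y) Filter.atTop (nhds (∫ _ : V, (0 : ℝ))) := by
    refine tendsto_integral_of_dominated_convergence _ (fun k => (i1 k).aestronglyMeasurable)
      (hint.const_mul (4 * C)) (fun k => Filter.Eventually.of_forall (ub k))
      (Filter.Eventually.of_forall fun y => ?_)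
    have : Filter.Tendsto (fun k => u y * (-(2 * e k * ⟪y, v⟫) / (1 + e k * ‖y‖ ^ 2) ^ 2))
        Filter.atTop (nhds (u y * (-(2 * 0 * ⟪y, v⟫) / (1 + 0 * ‖y‖ ^ 2) ^ 2))) := by
      refine Filter.Tendsto.const_mul _ (Filter.Tendsto.div ?_ ?_ (by norm_num))
      · exact ((elim.const_mul 2).mul_const _).neg
      · exact ((elim.mul_const _).const_add 1).pow 2
    simpa using this
  have l2 : Filter.Tendsto (fun k => ∫ y, u' y * g k y) Filter.atTop (nhds (∫ y, u' y)) := by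
    refine tendsto_integral_of_dominated_convergence _ m2
      (hint.const_mul C) (fun k => Filter.Eventually.of_forall (u'b k))
      (Filter.Eventually.of_forall fun y => ?_)
    have : Filter.Tendsto (fun k => u' y * (1 + e k * ‖y‖ ^ 2)⁻¹)
        Filter.atTop (nhds (u' y * (1 + 0 * ‖y‖ ^ 2)⁻¹)) :=
      Filter.Tendsto.const_mul _ (Filter.Tendsto.inv₀ ((elim.mul_const _).const_add 1) (by norm_num))
    simpa using this
  have l3 := tendsto_nhds_unique (l1.congr key) l2.neg
  simp at l3
  linarith

lemma plane_finrank (d : ℕ) (hd : 3 ≤ d) (ω : EuclideanSpace ℝ (Fin d)) (hω : ‖ω‖ = 1) :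
    ((d : ℝ) - 1) = Module.finrank ℝ ((ℝ ∙ ω)ᗮ : Submodule ℝ (EuclideanSpace ℝ (Fin d))) := by
  have : Fact (Module.finrank ℝ (EuclideanSpace ℝ (Fin d)) = (d - 1) + 1) :=
    ⟨by simp; omega⟩
  rw [Submodule.finrank_orthogonal_span_singleton (n := d - 1) (by
    intro h0; simp [h0] at hω)]
  rw [Nat.cast_sub (by omega)]; simp

lemma plane_jb (d : ℕ) (ω : EuclideanSpace ℝ (Fin d)) (p : ℝ) :
    ∀ (s : ℝ), s ≤ 0 → ∀ y : ((ℝ ∙ ω)ᗮ : Submodule ℝ (EuclideanSpace ℝ (Fin d))),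
      jb s (p • ω + (y : EuclideanSpace ℝ (Fin d))) ≤ jb s y := fun s hs y => by
    unfold jb
    refine Real.rpow_le_rpow_of_nonpos (by positivity) ?_ hs
    have h1 : ⟪ω, (y : EuclideanSpace ℝ (Fin d))⟫ = 0 :=
      Submodule.mem_orthogonal_singleton_iff_inner_right.1 y.2
    have := norm_add_sq_eq_norm_sq_add_norm_sq_of_inner_eq_zero (p • ω)
      (y : EuclideanSpace ℝ (Fin d)) (by rw [inner_smul_left, h1, mul_zero])
    simp only [Submodule.coe_norm]
    nlinarith [norm_nonneg (p • ω)]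

lemma u_main (d : ℕ) (hd : 3 ≤ d) (h : 𝓢(EuclideanSpace ℝ (Fin d), ℝ))
    (w ω θ : EuclideanSpace ℝ (Fin d)) (hω : ‖ω‖ = 1) (hθ : ‖θ‖ = 1) (hωθ : ⟪ω, θ⟫ = 0) (p : ℝ) :
    Integrable (fun y : ((ℝ ∙ ω)ᗮ : Submodule ℝ (EuclideanSpace ℝ (Fin d))) =>
      fderiv ℝ (fun x => ∫ y, (∂_{w} h) (x - y) * nk d y) (p • ω + y) θ) ∧
    ∫ y : ((ℝ ∙ ω)ᗮ : Submodule ℝ (EuclideanSpace ℝ (Fin d))),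
      fderiv ℝ (fun x => ∫ y, (∂_{w} h) (x - y) * nk d y) (p • ω + y) θ = 0 := by
  have hd' : (3 : ℝ) ≤ d := by exact_mod_cast hd
  have hnk : ∀ y, |nk d y| ≤ 1 * (1 + k0 d y) := fun y => by
    rw [abs_of_nonneg (nk_nonneg d y), one_mul]; exact nk_le d hd y
  set U : EuclideanSpace ℝ (Fin d) → ℝ := fun x => ∫ y, (∂_{w} h) (x - y) * nk d y with hU
  have hdiff : Differentiable ℝ U := fun x =>
    (conv_hasFDerivAt d hd (∂_{w} h) (nk d) (nk_meas d) 1 zero_le_one hnk x).differentiableAt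
  obtain ⟨C₁, hC₁, b1⟩ := bound_u d hd h w
  obtain ⟨C₂, hC₂, b2⟩ := bound_du d hd h θ w
  have hfin := plane_finrank d hd ω hω
  have hmem : θ ∈ (ℝ ∙ ω)ᗮ := Submodule.mem_orthogonal_singleton_iff_inner_right.2 hωθ
  have hjb := plane_jb d ω p
  refine integral_lineDeriv_zero ((d : ℝ) - 1) hfin
    (fun y : ((ℝ ∙ ω)ᗮ : Submodule ℝ (EuclideanSpace ℝ (Fin d))) => U (p • ω + y)) _ ⟨θ, hmem⟩
    (by simpa using hθ) (C₁ + C₂) (by positivity) ?_ ?_ ?_ ?_ ?_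
  · exact hdiff.continuous.comp (by fun_prop)
  · exact (measurable_fderiv_apply_const ℝ U θ).comp
      (by fun_prop : Continuous fun y : ((ℝ ∙ ω)ᗮ : Submodule ℝ (EuclideanSpace ℝ (Fin d))) =>
        (p • ω + (y : EuclideanSpace ℝ (Fin d)))).measurable
  · intro y
    have := (hdiff (p • ω + y)).hasFDerivAt.hasLineDerivAt θ
    unfold HasLineDerivAt at this ⊢
    simpa [add_assoc] using this
  · intro y
    refine (b1 _).trans ?_
    have := jb_pos (-(((d : ℝ) - 1) / 2)) y
    have := hjb (-(((d : ℝ) - 1) / 2)) (by linarith) y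
    exact mul_le_mul (by linarith) this (jb_pos _ _).le (by positivity)
  · intro y
    rw [conv_fderiv_apply d hd (∂_{w} h) (nk d) (nk_meas d) 1 zero_le_one hnk]
    refine (b2 _).trans ?_
    rw [show ((d : ℝ) - 1 + 1) / 2 = (d : ℝ) / 2 by ring]
    have := jb_pos (-((d : ℝ) / 2)) y
    have := hjb (-((d : ℝ) / 2)) (by linarith) y
    exact mul_le_mul (by linarith) this (jb_pos _ _).le (by positivity)

/-- every longitudinal Radon transform of the potential part `F^p = ∇φ`
vanishes, and the longitudinal transforms of `F` coincide with those of the solenoidal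
part `F^s = F − ∇φ`. -/
theorem stmt18 (d : ℕ) (hd : 3 ≤ d)
    (F : EuclideanSpace ℝ (Fin d) → EuclideanSpace ℝ (Fin d))
    (hF : ∀ j : Fin d, IsSchwartz (fun x => ⟪canE d j, F x⟫))
    (Φ : EuclideanSpace ℝ (Fin d) → ℝ) (hΦ : ∀ x, Φ x = vdiv F x)
    (φ : EuclideanSpace ℝ (Fin d) → ℝ)
    (hφ : ∀ x, φ x = ∫ y, Φ y * fundSol d (x - y)) :
    ∀ ω θ : EuclideanSpace ℝ (Fin d), ‖ω‖ = 1 → ‖θ‖ = 1 → ⟪ω, θ⟫ = 0 → ∀ p : ℝ,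
      Dlong (fun x => gradient φ x) ω θ p = 0 ∧
      Dlong F ω θ p = Dlong (fun x => F x - gradient φ x) ω θ p := by
  intro ω θ hω hθ hωθ p
  have hnk : ∀ y, |nk d y| ≤ 1 * (1 + k0 d y) := fun y => by
    rw [abs_of_nonneg (nk_nonneg d y), one_mul]; exact nk_le d hd y
  choose f hf using hF
  set c : ℝ := -(Real.Gamma ((d : ℝ) / 2 - 1) / (4 * Real.pi ^ ((d : ℝ) / 2))) with hc
  let U : Fin d → EuclideanSpace ℝ (Fin d) → ℝ :=
    fun j x => ∫ y, (∂_{canE d j} (f j)) (x - y) * nk d y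
  have hUd : ∀ j, Differentiable ℝ (U j) := fun j x =>
    (conv_hasFDerivAt d hd (∂_{canE d j} (f j)) (nk d) (nk_meas d) 1 zero_le_one hnk
      x).differentiableAt
  have hΦ' : ∀ x, Φ x = ∑ j, (∂_{canE d j} (f j)) x := fun x => by
    rw [hΦ, vdiv]
    refine Finset.sum_congr rfl fun j _ => ?_
    rw [SchwartzMap.lineDerivOp_apply_eq_fderiv, show (fun y => ⟪canE d j, F y⟫) = f j from
      funext (hf j)]
  have hφ' : φ = fun x => c * ∑ j, U j x := by
    funext x
    rw [hφ, ← integral_sub_left_eq_self _ volume x]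
    simp only [sub_sub_cancel]
    simp only [U]
    rw [← integral_finsetSum _ (fun j _ => by
      simpa [mul_comm] using conv_integrable d hd (∂_{canE d j} (f j)) (nk d) (nk_meas d) 1
        zero_le_one hnk x), ← integral_const_mul]
    congr 1
    funext y
    rw [hΦ', ← Finset.sum_mul, fundSol, ← hc, nk]
    ring
  have hgrad : ∀ x, ⟪θ, gradient φ x⟫ = c * ∑ j, fderiv ℝ (U j) x θ := fun x => by
    rw [real_inner_comm, inner_gradient_left, hφ', fderiv_const_mul
      (DifferentiableAt.fun_sum fun j _ => hUd j x), fderiv_fun_sum fun j _ => hUd j x]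
    simp
  have hmain := fun j => u_main d hd (f j) (canE d j) ω θ hω hθ hωθ p
  have hIg : Integrable (fun y : ((ℝ ∙ ω)ᗮ : Submodule ℝ (EuclideanSpace ℝ (Fin d))) =>
      ⟪θ, gradient φ (p • ω + y)⟫) := by
    simp only [hgrad]
    exact (integrable_finsetSum _ fun j _ => (hmain j).1).const_mul c
  have hzero : Dlong (fun x => gradient φ x) ω θ p = 0 := by
    unfold Dlong RadonT
    simp only [hgrad]
    rw [integral_const_mul, integral_finsetSum _ fun j _ => (hmain j).1,
      Finset.sum_eq_zero fun j _ => (hmain j).2, mul_zero]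
  refine ⟨hzero, ?_⟩
  have hIF : Integrable (fun y : ((ℝ ∙ ω)ᗮ : Submodule ℝ (EuclideanSpace ℝ (Fin d))) =>
      ⟪θ, F (p • ω + y)⟫) := by
    have hd' : (3 : ℝ) ≤ d := by exact_mod_cast hd
    have hexp : ∀ x, ⟪θ, F x⟫ = ∑ j, θ j * f j x := fun x => by
      rw [PiLp.inner_apply]
      refine Finset.sum_congr rfl fun j _ => ?_
      have h1 : f j x = F x j := by
        rw [← hf j x]; simp [canE, EuclideanSpace.inner_single_left]
      rw [h1]
      simp [mul_comm]
    simp only [hexp]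
    refine integrable_finsetSum _ fun j _ => Integrable.const_mul ?_ _
    obtain ⟨C, hC, hb⟩ := schwartz_decay (f j) d
    have hint : Integrable (jb (-(d : ℝ)) :
        ((ℝ ∙ ω)ᗮ : Submodule ℝ (EuclideanSpace ℝ (Fin d))) → ℝ) := by
      refine jb_integrable volume ?_
      rw [← plane_finrank d hd ω hω]; linarith
    refine (hint.const_mul C).mono' ?_ (Filter.Eventually.of_forall fun y => ?_)
    · exact ((f j).continuous.comp (by fun_prop)).aestronglyMeasurable
    · refine (hb _).trans ?_
      exact mul_le_mul_of_nonneg_left (plane_jb d ω p _ (by linarith) y) hC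
  unfold Dlong RadonT at hzero ⊢
  simp only [inner_sub_right]
  rw [integral_sub hIF hIg, hzero, sub_zero]
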